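/- arXiv:1204.4290 — 2 statements merged into one kernel-verified Lean document; each statement's English description precedes it below -/
import Mathlib

section
/- Uniqueness of the 𝔭₂-invariant covariant metric on the region x·x > 0: let U = {x ∈ ℝ⁴ : x·x > 0 and x⁰ > 0}. If g : U → (symmetric 4×4 real matrices), x ↦ (g_{μν}(x)), is smooth and satisfies (ℒ_ξ g)_{μν} = 0 on U for every 𝔭₂ vector field ξ, then there exists a constant C ∈ ℝ such that g_{μν}(x) = C · (x_μ x_ν − (x·x) η_{μν}) / (x·x)² for all x ∈ U. -/
noncomputable section

open scoped BigOperators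

/-- The Minkowski metric η = diag(1,−1,−1,−1), as a function of two indices. -/
def etaF : Fin 4 → Fin 4 → ℝ := fun μ ν => if μ = ν then (if μ = 0 then 1 else -1) else 0

/-- The Minkowski product x·y = η_{μν} x^μ y^ν. -/
def mdot (x y : Fin 4 → ℝ) : ℝ := ∑ μ, ∑ ν, etaF μ ν * x μ * y ν

/-- The lowered index x_μ = η_{μν} x^ν. -/
def lowr (x : Fin 4 → ℝ) (μ : Fin 4) : ℝ := ∑ ν, etaF μ ν * x ν

/-- The partial derivative ∂_λ f (x). -/
def pdv (f : (Fin 4 → ℝ) → ℝ) (lam : Fin 4) (x : Fin 4 → ℝ) : ℝ :=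
  fderiv ℝ f x (Pi.single lam 1)

/-- A ∈ 𝔰𝔬(1,3), i.e. Aᵀη + ηA = 0, written componentwise. -/
def so13 (A : Fin 4 → Fin 4 → ℝ) : Prop :=
  ∀ μ ν, (∑ κ, A κ μ * etaF κ ν) + (∑ κ, etaF μ κ * A κ ν) = 0

/-- The 𝔭₂ vector field ξ(x) = A x + (b·x) x. -/
def xiP2 (A : Fin 4 → Fin 4 → ℝ) (b : Fin 4 → ℝ) (x : Fin 4 → ℝ) : Fin 4 → ℝ :=
  fun μ => (∑ ν, A μ ν * x ν) + mdot b x * x μ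

/-- Lie derivative of a covariant symmetric 2-tensor field g along a vector field ξ:
  (ℒ_ξ g)_{μν} = ξ^λ ∂_λ g_{μν} + g_{μλ} ∂_ν ξ^λ + g_{λν} ∂_μ ξ^λ. -/
def lieG (ξf : (Fin 4 → ℝ) → Fin 4 → ℝ) (g : (Fin 4 → ℝ) → Fin 4 → Fin 4 → ℝ)
    (x : Fin 4 → ℝ) (μ ν : Fin 4) : ℝ :=
  (∑ lam, ξf x lam * pdv (fun y => g y μ ν) lam x)
  + (∑ lam, g x μ lam * pdv (fun y => ξf y lam) ν x)
  + (∑ lam, g x lam ν * pdv (fun y => ξf y lam) μ x)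

/-- Lie derivative of a contravariant symmetric 2-tensor field h along a vector field ξ:
  (ℒ_ξ h)^{μν} = ξ^λ ∂_λ h^{μν} − h^{μλ} ∂_λ ξ^ν − h^{λν} ∂_λ ξ^μ. -/
def lieH (ξf : (Fin 4 → ℝ) → Fin 4 → ℝ) (h : (Fin 4 → ℝ) → Fin 4 → Fin 4 → ℝ)
    (x : Fin 4 → ℝ) (μ ν : Fin 4) : ℝ :=
  (∑ lam, ξf x lam * pdv (fun y => h y μ ν) lam x)
  - (∑ lam, h x μ lam * pdv (fun y => ξf y ν) lam x)
  - (∑ lam, h x lam ν * pdv (fun y => ξf y μ) lam x)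

/-- Lie derivative of a connection Γ^μ_{νρ} along a vector field ξ ([ℒ_ξ, ∇]):
  ξ^λ ∂_λ Γ^μ_{νρ} − Γ^λ_{νρ} ∂_λ ξ^μ + Γ^μ_{λρ} ∂_ν ξ^λ + Γ^μ_{νλ} ∂_ρ ξ^λ + ∂_ν ∂_ρ ξ^μ. -/
def lieConn (ξf : (Fin 4 → ℝ) → Fin 4 → ℝ)
    (Γ : (Fin 4 → ℝ) → Fin 4 → Fin 4 → Fin 4 → ℝ)
    (x : Fin 4 → ℝ) (μ ν ρ : Fin 4) : ℝ :=
  (∑ lam, ξf x lam * pdv (fun y => Γ y μ ν ρ) lam x)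
  - (∑ lam, Γ x lam ν ρ * pdv (fun y => ξf y μ) lam x)
  + (∑ lam, Γ x μ lam ρ * pdv (fun y => ξf y lam) ν x)
  + (∑ lam, Γ x μ ν lam * pdv (fun y => ξf y lam) ρ x)
  + pdv (fun y => pdv (fun z => ξf z μ) ρ y) ν x

/-- The canonical degenerate covariant metric g_{μν}(x) = (x_μ x_ν − (x·x) η_{μν})/(x·x)². -/
def gC (x : Fin 4 → ℝ) (μ ν : Fin 4) : ℝ :=
  (lowr x μ * lowr x ν - mdot x x * etaF μ ν) / (mdot x x) ^ 2

/-- The canonical degenerate contravariant metric h^{μν}(x) = (x·x) x^μ x^ν. -/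
def hC (x : Fin 4 → ℝ) (μ ν : Fin 4) : ℝ := mdot x x * x μ * x ν

/-- The canonical connection Γ^μ_{νλ}(x) = −(x_ν δ^μ_λ + δ^μ_ν x_λ)/(x·x). -/
def GammaC (x : Fin 4 → ℝ) (μ ν lam : Fin 4) : ℝ :=
  -(lowr x ν * (if μ = lam then 1 else 0) + (if μ = ν then 1 else 0) * lowr x lam) / mdot x x

lemma mdot_explicit (x y : Fin 4 → ℝ) :
    mdot x y = x 0 * y 0 - x 1 * y 1 - x 2 * y 2 - x 3 * y 3 := by
  simp [mdot, etaF, Fin.sum_univ_four]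
  ring

lemma lowr_zero (x : Fin 4 → ℝ) : lowr x 0 = x 0 := by
  simp [lowr, etaF, Fin.sum_univ_four]
lemma lowr_one (x : Fin 4 → ℝ) : lowr x 1 = - x 1 := by
  simp [lowr, etaF, Fin.sum_univ_four]
lemma lowr_two (x : Fin 4 → ℝ) : lowr x 2 = - x 2 := by
  simp [lowr, etaF, Fin.sum_univ_four]
lemma lowr_three (x : Fin 4 → ℝ) : lowr x 3 = - x 3 := by
  simp [lowr, etaF, Fin.sum_univ_four]

lemma mdot_lowr (x y : Fin 4 → ℝ) : mdot x y = ∑ ν, lowr x ν * y ν := by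
  simp [mdot_explicit, Fin.sum_univ_four, lowr_zero, lowr_one, lowr_two, lowr_three]
  ring

/-- The generator u ∧ v. -/
def wedge (u v : Fin 4 → ℝ) : Fin 4 → Fin 4 → ℝ :=
  fun μ ν => u μ * lowr v ν - v μ * lowr u ν

lemma so13_wedge (u v : Fin 4 → ℝ) : so13 (wedge u v) := by
  intro μ ν
  fin_cases μ <;> fin_cases ν <;>
    simp [wedge, etaF, Fin.sum_univ_four, lowr_zero, lowr_one, lowr_two, lowr_three] <;> ring

lemma so13_zero : so13 0 := by
  intro μ ν
  simp

lemma wedge_apply (u v x : Fin 4 → ℝ) (μ : Fin 4) :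
    ∑ ν, wedge u v μ ν * x ν = u μ * mdot v x - v μ * mdot u x := by
  simp only [wedge, mdot_lowr, Fin.sum_univ_four]
  ring

lemma pdv_xi (A : Fin 4 → Fin 4 → ℝ) (b x : Fin 4 → ℝ) (lam ν : Fin 4) :
    pdv (fun y => xiP2 A b y lam) ν x
      = A lam ν + lowr b ν * x lam + mdot b x * (if lam = ν then 1 else 0) := by
  have hc : ∀ i : Fin 4, HasFDerivAt (fun y : Fin 4 → ℝ => y i)
      (ContinuousLinearMap.proj (R := ℝ) (φ := fun _ : Fin 4 => ℝ) i) x :=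
    fun i => hasFDerivAt_apply i x
  have h1 : HasFDerivAt (fun y : Fin 4 → ℝ => ∑ i, A lam i * y i)
      (∑ i, A lam i • (ContinuousLinearMap.proj (R := ℝ) (φ := fun _ : Fin 4 => ℝ) i)) x :=
    HasFDerivAt.fun_sum fun i _ => (hc i).const_mul _
  have h2 : HasFDerivAt (fun y : Fin 4 → ℝ => ∑ i, lowr b i * y i)
      (∑ i, lowr b i • (ContinuousLinearMap.proj (R := ℝ) (φ := fun _ : Fin 4 => ℝ) i)) x :=
    HasFDerivAt.fun_sum fun i _ => (hc i).const_mul _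
  have h3 := h1.add (h2.mul (hc lam))
  have he : (fun y => xiP2 A b y lam) =
      (fun y : Fin 4 → ℝ => ∑ i, A lam i * y i) +
        (fun y : Fin 4 → ℝ => ∑ i, lowr b i * y i) * (fun y => y lam) := by
    funext y
    simp [xiP2, mdot_lowr]
  unfold pdv
  rw [he, h3.fderiv, mdot_lowr]
  simp [Pi.single_apply]
  ring

lemma convex_U : Convex ℝ {x : Fin 4 → ℝ | 0 < mdot x x ∧ 0 < x 0} := by
  rw [convex_iff_forall_pos]
  rintro x ⟨hx, hx0⟩ y ⟨hy, hy0⟩ a b ha hb -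
  rw [mdot_explicit] at hx hy
  have hxy : x 1 * y 1 + x 2 * y 2 + x 3 * y 3 < x 0 * y 0 := by
    apply lt_of_pow_lt_pow_left₀ 2 (by positivity)
    have hcs : (x 1 * y 1 + x 2 * y 2 + x 3 * y 3) ^ 2
        ≤ (x 1 ^ 2 + x 2 ^ 2 + x 3 ^ 2) * (y 1 ^ 2 + y 2 ^ 2 + y 3 ^ 2) := by
      nlinarith [sq_nonneg (x 1 * y 2 - x 2 * y 1), sq_nonneg (x 1 * y 3 - x 3 * y 1),
        sq_nonneg (x 2 * y 3 - x 3 * y 2)]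
    have h1 : x 1 ^ 2 + x 2 ^ 2 + x 3 ^ 2 < x 0 ^ 2 := by nlinarith
    have h2 : y 1 ^ 2 + y 2 ^ 2 + y 3 ^ 2 < y 0 ^ 2 := by nlinarith
    have h3 : (x 1 ^ 2 + x 2 ^ 2 + x 3 ^ 2) * (y 1 ^ 2 + y 2 ^ 2 + y 3 ^ 2)
        < x 0 ^ 2 * y 0 ^ 2 :=
      mul_lt_mul'' h1 h2 (by positivity) (by positivity)
    nlinarith
  refine ⟨?_, ?_⟩
  · rw [mdot_explicit]
    simp only [Pi.add_apply, Pi.smul_apply, smul_eq_mul]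
    have e1 := mul_pos (mul_pos ha ha) hx
    have e2 := mul_pos (mul_pos hb hb) hy
    have e3 := mul_pos (mul_pos ha hb) (sub_pos.2 hxy)
    nlinarith
  · simp only [Pi.add_apply, Pi.smul_apply, smul_eq_mul]
    positivity

lemma isOpen_U : IsOpen {x : Fin 4 → ℝ | 0 < mdot x x ∧ 0 < x 0} := by
  simp only [mdot_explicit]
  have h1 : IsOpen {x : Fin 4 → ℝ | 0 < x 0 * x 0 - x 1 * x 1 - x 2 * x 2 - x 3 * x 3} :=
    isOpen_lt continuous_const (by fun_prop)
  have h2 : IsOpen {x : Fin 4 → ℝ | 0 < x 0} := isOpen_lt continuous_const (by fun_prop)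
  exact h1.inter h2

/-- Lie equation, with derivatives of ξ made explicit. -/
lemma lie_explicit (g : (Fin 4 → ℝ) → Fin 4 → Fin 4 → ℝ) (A : Fin 4 → Fin 4 → ℝ)
    (b x : Fin 4 → ℝ) (μ ν : Fin 4) :
    lieG (xiP2 A b) g x μ ν =
      fderiv ℝ (fun y => g y μ ν) x (xiP2 A b x)
      + ((∑ lam, g x μ lam * A lam ν) + lowr b ν * (∑ lam, g x μ lam * x lam)
          + mdot b x * g x μ ν)
      + ((∑ lam, g x lam ν * A lam μ) + lowr b μ * (∑ lam, g x lam ν * x lam)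
          + mdot b x * g x μ ν) := by
  have h0 : fderiv ℝ (fun y => g y μ ν) x (xiP2 A b x)
      = ∑ lam, xiP2 A b x lam * pdv (fun y => g y μ ν) lam x := by
    conv_lhs => rw [pi_eq_sum_univ' (xiP2 A b x)]
    simp [pdv, map_sum]
  have h1 : ∀ i : Fin 4, (∑ lam, g x μ lam * (if lam = i then (1:ℝ) else 0)) = g x μ i := by
    intro i; simp
  have h2 : ∀ i : Fin 4, (∑ lam, g x lam ν * (if lam = i then (1:ℝ) else 0)) = g x i ν := by
    intro i; simp
  unfold lieG
  rw [h0]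
  simp only [pdv_xi]
  have e1 : ∑ lam, g x μ lam * (A lam ν + lowr b ν * x lam + mdot b x * if lam = ν then 1 else 0)
      = (∑ lam, g x μ lam * A lam ν) + lowr b ν * (∑ lam, g x μ lam * x lam)
          + mdot b x * g x μ ν := by
    rw [← h1 ν, Finset.mul_sum, Finset.mul_sum, ← Finset.sum_add_distrib,
      ← Finset.sum_add_distrib]
    exact Finset.sum_congr rfl fun i _ => by ring
  have e2 : ∑ lam, g x lam ν * (A lam μ + lowr b μ * x lam + mdot b x * if lam = μ then 1 else 0)
      = (∑ lam, g x lam ν * A lam μ) + lowr b μ * (∑ lam, g x lam ν * x lam)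
          + mdot b x * g x μ ν := by
    rw [← h2 μ, Finset.mul_sum, Finset.mul_sum, ← Finset.sum_add_distrib,
      ← Finset.sum_add_distrib]
    exact Finset.sum_congr rfl fun i _ => by ring
  rw [e1, e2]

lemma kernel_x (g : (Fin 4 → ℝ) → Fin 4 → Fin 4 → ℝ) (x : Fin 4 → ℝ) (hx : 0 < x 0)
    (hs : ∀ μ ν, g x μ ν = g x ν μ)
    (h : ∀ b : Fin 4 → ℝ, ∀ μ ν, lieG (xiP2 0 b) g x μ ν = 0) (μ : Fin 4) :
    ∑ lam, g x μ lam * x lam = 0 := by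
  set v : Fin 4 → ℝ := fun μ => ∑ lam, g x μ lam * x lam with hv
  have hv2 : ∀ ν, ∑ lam, g x lam ν * x lam = v ν := by
    intro ν
    simp only [hv]
    exact Finset.sum_congr rfl fun i _ => by rw [hs]
  have key : ∀ b : Fin 4 → ℝ, mdot b x = 0 → ∀ μ ν, lowr b ν * v μ + lowr b μ * v ν = 0 := by
    intro b hb μ ν
    have := h b μ ν
    rw [lie_explicit, hv2] at this
    have hz : xiP2 0 b x = 0 := by
      funext i; simp [xiP2, hb]
    rw [hz, hb] at this
    simpa [hv] using this
  show v μ = 0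
  have k := key ![x 1, x 0, 0, 0] (by simp [mdot_explicit]; ring)
  have k1 : v 1 = 0 := by
    have := k 1 1
    simp [lowr_one] at this
    rcases this with h | h
    · exact absurd h hx.ne'
    · exact h
  have := k 1 μ
  simp [lowr_one, k1] at this
  rcases this with h | h
  · exact absurd h hx.ne'
  · exact h

lemma euler_x (g : (Fin 4 → ℝ) → Fin 4 → Fin 4 → ℝ) (x : Fin 4 → ℝ) (hx : 0 < mdot x x)
    (hs : ∀ μ ν, g x μ ν = g x ν μ)
    (hk : ∀ μ, ∑ lam, g x μ lam * x lam = 0)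
    (h : ∀ b : Fin 4 → ℝ, ∀ μ ν, lieG (xiP2 0 b) g x μ ν = 0) (μ ν : Fin 4) :
    fderiv ℝ (fun y => g y μ ν) x x = - 2 * g x μ ν := by
  have hk2 : ∑ lam, g x lam ν * x lam = 0 := by
    rw [← hk ν]
    exact Finset.sum_congr rfl fun i _ => by rw [hs]
  have := h x μ ν
  rw [lie_explicit, hk, hk2] at this
  have hz : xiP2 0 x x = mdot x x • x := by
    funext i; simp [xiP2]
  rw [hz, map_smul] at this
  simp at this
  apply mul_left_cancel₀ hx.ne'
  linarith

lemma algebra_x (G : Fin 4 → Fin 4 → ℝ) (x : Fin 4 → ℝ) (hx : 0 < mdot x x)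
    (hs : ∀ μ ν, G μ ν = G ν μ)
    (hk : ∀ μ, ∑ lam, G μ lam * x lam = 0)
    (h : ∀ u v : Fin 4 → ℝ, mdot u x = 0 → mdot v x = 0 → ∀ μ ν,
      (∑ lam, G μ lam * wedge u v lam ν) + (∑ lam, G lam ν * wedge u v lam μ) = 0)
    (μ ν : Fin 4) :
    3 * mdot x x * G μ ν = (G 0 0 - G 1 1 - G 2 2 - G 3 3)
      * (mdot x x * etaF μ ν - lowr x μ * lowr x ν) := by
  set q := mdot x x with hq
  -- projected basis vectors
  let u : Fin 4 → Fin 4 → ℝ := fun a i => q * (if i = a then 1 else 0) - lowr x a * x i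
  have hlow : ∀ a c, lowr (u a) c = q * etaF c a - lowr x a * lowr x c := by
    intro a c
    have : lowr (u a) c = ∑ i, etaF c i * u a i := rfl
    rw [this]
    simp only [u, mul_sub, Finset.sum_sub_distrib]
    congr 1
    · simp; ring
    · simp only [lowr, Finset.mul_sum]
      refine Finset.sum_congr rfl fun i _ => by ring
  have hperp : ∀ a, mdot (u a) x = 0 := by
    intro a
    rw [mdot_lowr]
    simp only [hlow, sub_mul, Finset.sum_sub_distrib]
    have e1 : ∑ c, lowr x a * lowr x c * x c = lowr x a * q := by
      rw [hq, mdot_lowr x x, Finset.mul_sum]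
      exact Finset.sum_congr rfl fun i _ => by ring
    rw [e1]
    have e2 : ∑ c, q * etaF c a * x c = q * lowr x a := by
      simp only [lowr, Finset.mul_sum]
      refine Finset.sum_congr rfl fun i _ => ?_
      have : etaF i a = etaF a i := by
        fin_cases i <;> fin_cases a <;> simp [etaF]
      rw [this]; ring
    rw [e2]; ring
  have hG : ∀ a d, ∑ lam, G d lam * u a lam = q * G d a := by
    intro a d
    have : ∀ lam, G d lam * u a lam
        = q * (G d lam * (if lam = a then 1 else 0)) - lowr x a * (G d lam * x lam) := by
      intro lam; simp only [u]; ring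
    simp only [this, Finset.sum_sub_distrib, ← Finset.mul_sum, hk]
    simp
  have main : ∀ a b c d, G d a * lowr (u b) c - G d b * lowr (u a) c
      + G c a * lowr (u b) d - G c b * lowr (u a) d = 0 := by
    intro a b c d
    have h1 := h (u a) (u b) (hperp a) (hperp b) d c
    have e : ∀ d c, ∑ lam, G d lam * wedge (u a) (u b) lam c
        = q * G d a * lowr (u b) c - q * G d b * lowr (u a) c := by
      intro d c
      rw [← hG, ← hG, Finset.sum_mul, Finset.sum_mul, ← Finset.sum_sub_distrib]
      exact Finset.sum_congr rfl fun i _ => by simp only [wedge]; ring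
    have e' : ∑ lam, G lam c * wedge (u a) (u b) lam d
        = ∑ lam, G c lam * wedge (u a) (u b) lam d :=
      Finset.sum_congr rfl fun i _ => by rw [hs]
    rw [e', e, e] at h1
    apply mul_left_cancel₀ hx.ne'
    linear_combination h1
  have m0 := main μ 0 0 ν
  have m1 := main μ 1 1 ν
  have m2 := main μ 2 2 ν
  have m3 := main μ 3 3 ν
  have hkν := hk ν
  have hkμ := hk μ
  have qe : q = x 0 * x 0 - x 1 * x 1 - x 2 * x 2 - x 3 * x 3 := mdot_explicit x x
  clear_value q u
  simp only [hlow] at m0 m1 m2 m3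
  rw [hs 0 μ] at m0
  rw [hs 1 μ] at m1
  rw [hs 2 μ] at m2
  rw [hs 3 μ] at m3
  simp only [Fin.sum_univ_four] at hkν hkμ
  have E : ∀ a b, G a 0 * etaF 0 b - G a 1 * etaF 1 b - G a 2 * etaF 2 b - G a 3 * etaF 3 b
      = G a b := by
    intro a b
    fin_cases b <;> simp [etaF]
  have E' : ∀ a b, G a 0 * etaF b 0 - G a 1 * etaF b 1 - G a 2 * etaF b 2 - G a 3 * etaF b 3
      = G a b := by
    intro a b
    fin_cases b <;> simp [etaF]
  have es : etaF ν μ = etaF μ ν := by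
    fin_cases μ <;> fin_cases ν <;> simp [etaF]
  have d0 : etaF 0 0 = 1 := by simp [etaF]
  have d1 : etaF 1 1 = -1 := by simp [etaF]
  have d2 : etaF 2 2 = -1 := by simp [etaF]
  have d3 : etaF 3 3 = -1 := by simp [etaF]
  simp only [lowr_zero, lowr_one, lowr_two, lowr_three, d0, d1, d2, d3, es] at m0 m1 m2 m3
  rw [hs ν μ] at m0 m1 m2 m3
  have E1 := E ν μ
  have E2 := E' μ ν
  rw [hs ν μ] at E1
  linear_combination m0 - m1 - m2 - m3 - lowr x μ * hkν + lowr x ν * hkμ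
    + q * E1 - q * E2 - G μ ν * qe

lemma trace_deriv (g : (Fin 4 → ℝ) → Fin 4 → Fin 4 → ℝ) (x w : Fin 4 → ℝ) (hx : 0 < mdot x x)
    (hs : ∀ μ ν, g x μ ν = g x ν μ)
    (he : ∀ μ ν, fderiv ℝ (fun y => g y μ ν) x x = - 2 * g x μ ν)
    (h : ∀ A : Fin 4 → Fin 4 → ℝ, so13 A → ∀ μ ν, lieG (xiP2 A 0) g x μ ν = 0) :
    mdot x x * (fderiv ℝ (fun y => g y 0 0) x w - fderiv ℝ (fun y => g y 1 1) x w
      - fderiv ℝ (fun y => g y 2 2) x w - fderiv ℝ (fun y => g y 3 3) x w)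
      = - 2 * mdot w x * (g x 0 0 - g x 1 1 - g x 2 2 - g x 3 3) := by
  have hxi : xiP2 (wedge x w) 0 x = mdot w x • x - mdot x x • w := by
    funext i
    simp only [xiP2, wedge_apply]
    simp [mdot_explicit]; ring
  have key : ∀ μ, mdot x x * fderiv ℝ (fun y => g y μ μ) x w
      = - 2 * mdot w x * g x μ μ + 2 * ∑ lam, g x μ lam * wedge x w lam μ := by
    intro μ
    have := h _ (so13_wedge x w) μ μ
    rw [lie_explicit, hxi, map_sub, map_smul, map_smul, he] at this
    have e' : ∑ lam, g x lam μ * wedge x w lam μ = ∑ lam, g x μ lam * wedge x w lam μ :=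
      Finset.sum_congr rfl fun i _ => by rw [hs]
    have z : mdot 0 x = 0 := by simp [mdot_explicit]
    have z' : lowr 0 μ = 0 := by simp [lowr]
    rw [e', z, z'] at this
    simp only [smul_eq_mul] at this
    linarith
  have k0 := key 0
  have k1 := key 1
  have k2 := key 2
  have k3 := key 3
  simp only [wedge, Fin.sum_univ_four, lowr_zero, lowr_one, lowr_two, lowr_three] at k0 k1 k2 k3
  rw [hs 1 0] at k1
  rw [hs 2 0, hs 2 1] at k2
  rw [hs 3 0, hs 3 1, hs 3 2] at k3
  linear_combination k0 - k1 - k2 - k3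

/-- Uniqueness of the 𝔭₂-invariant covariant metric on the region x·x > 0, x⁰ > 0. -/
theorem stmt_2 (g : (Fin 4 → ℝ) → Fin 4 → Fin 4 → ℝ)
    (hsmooth : ∀ μ ν, ContDiffOn ℝ (⊤ : ℕ∞) (fun x => g x μ ν)
      {x : Fin 4 → ℝ | 0 < mdot x x ∧ 0 < x 0})
    (hsym : ∀ x ∈ {x : Fin 4 → ℝ | 0 < mdot x x ∧ 0 < x 0}, ∀ μ ν, g x μ ν = g x ν μ)
    (hinv : ∀ A : Fin 4 → Fin 4 → ℝ, ∀ b : Fin 4 → ℝ, so13 A →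
      ∀ x ∈ {x : Fin 4 → ℝ | 0 < mdot x x ∧ 0 < x 0}, ∀ μ ν, lieG (xiP2 A b) g x μ ν = 0) :
    ∃ C : ℝ, ∀ x ∈ {x : Fin 4 → ℝ | 0 < mdot x x ∧ 0 < x 0}, ∀ μ ν,
      g x μ ν = C * (lowr x μ * lowr x ν - mdot x x * etaF μ ν) / (mdot x x) ^ 2 := by
  set U := {x : Fin 4 → ℝ | 0 < mdot x x ∧ 0 < x 0} with hU
  have hd : ∀ x ∈ U, ∀ μ ν, DifferentiableAt ℝ (fun y => g y μ ν) x := fun x hx μ ν =>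
    ((hsmooth μ ν).contDiffAt (isOpen_U.mem_nhds hx)).differentiableAt (by simp)
  have hb : ∀ x ∈ U, ∀ b : Fin 4 → ℝ, ∀ μ ν, lieG (xiP2 0 b) g x μ ν = 0 :=
    fun x hx b => hinv 0 b so13_zero x hx
  have hk : ∀ x ∈ U, ∀ μ, ∑ lam, g x μ lam * x lam = 0 :=
    fun x hx => kernel_x g x hx.2 (hsym x hx) (hb x hx)
  have he : ∀ x ∈ U, ∀ μ ν, fderiv ℝ (fun y => g y μ ν) x x = - 2 * g x μ ν :=
    fun x hx => euler_x g x hx.1 (hsym x hx) (hk x hx) (hb x hx)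
  have halg : ∀ x ∈ U, ∀ μ ν, 3 * mdot x x * g x μ ν
      = (g x 0 0 - g x 1 1 - g x 2 2 - g x 3 3)
      * (mdot x x * etaF μ ν - lowr x μ * lowr x ν) := by
    intro x hx
    refine algebra_x (g x) x hx.1 (hsym x hx) (hk x hx) ?_
    intro u v hu hv μ ν
    have := hinv _ 0 (so13_wedge u v) x hx μ ν
    have hz : xiP2 (wedge u v) 0 x = 0 := by
      funext i
      simp only [xiP2, wedge_apply]
      simp [hu, hv, mdot_explicit 0]
    have z : mdot 0 x = 0 := by simp [mdot_explicit]
    have z' : ∀ μ, lowr 0 μ = 0 := by simp [lowr]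
    rw [lie_explicit, hz, z, z', z'] at this
    simpa using this
  let F : (Fin 4 → ℝ) → ℝ := fun x => (g x 0 0 - g x 1 1 - g x 2 2 - g x 3 3) * mdot x x
  have hFd : ∀ x ∈ U, HasFDerivAt F (0 : (Fin 4 → ℝ) →L[ℝ] ℝ) x := by
    intro x hx
    have ht := ((((hd x hx 0 0).hasFDerivAt.sub (hd x hx 1 1).hasFDerivAt).sub
      (hd x hx 2 2).hasFDerivAt).sub (hd x hx 3 3).hasFDerivAt)
    have hc : ∀ i : Fin 4, HasFDerivAt (fun y : Fin 4 → ℝ => y i)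
      (ContinuousLinearMap.proj (R := ℝ) (φ := fun _ : Fin 4 => ℝ) i) x :=
      fun i => hasFDerivAt_apply i x
    have hm := ((((hc 0).mul (hc 0)).sub ((hc 1).mul (hc 1))).sub
      ((hc 2).mul (hc 2))).sub ((hc 3).mul (hc 3))
    have hp := ht.mul hm
    have hF : F = (((((fun y => g y 0 0) - fun y => g y 1 1) - fun y => g y 2 2) - fun y => g y 3 3) *
      ((((fun y : Fin 4 → ℝ => y 0) * (fun y => y 0)
        - (fun y => y 1) * (fun y => y 1)) - (fun y => y 2) * (fun y => y 2))
        - (fun y => y 3) * (fun y => y 3))) := by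
      funext y
      simp [F, mdot_explicit]
    rw [hF]
    refine hp.congr_fderiv ?_
    ext1 w
    have := trace_deriv g x w hx.1 (hsym x hx) (he x hx) (fun A hA => hinv A 0 hA x hx)
    rw [mdot_explicit, mdot_explicit] at this
    simp
    linear_combination this
  have he0 : (Pi.single 0 1 : Fin 4 → ℝ) ∈ U := by
    constructor
    · simp [mdot_explicit]
    · simp
  have hconst : ∀ x ∈ U, F x = F (Pi.single 0 1) := by
    intro x hx
    refine convex_U.is_const_of_fderivWithin_eq_zero (𝕜 := ℝ)
      (fun y hy => (hFd y hy).differentiableAt.differentiableWithinAt) ?_ hx he0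
    intro y hy
    rw [fderivWithin_of_isOpen isOpen_U hy, (hFd y hy).fderiv]
  refine ⟨- F (Pi.single 0 1) / 3, ?_⟩
  intro x hx μ ν
  rw [← hconst x hx]
  have := halg x hx μ ν
  have hq : mdot x x ≠ 0 := hx.1.ne'
  simp only [F]
  field_simp
  linear_combination this
end
end

section
/- Maximum symmetry theorem: let U be either {x ∈ ℝ⁴ : x·x < 0} or {x ∈ ℝ⁴ : x·x > 0 and x⁰ > 0}, and on U define g_{μν}(x) = (x_μ x_ν − (x·x) η_{μν})/(x·x)², h^{μν}(x) = (x·x) x^μ x^ν, and Γ^μ_{νλ}(x) = −(x_ν δ^μ_λ + δ^μ_ν x_λ)/(x·x). If ξ : U → ℝ⁴ is a smooth vector field satisfying on U: (i) ξ^λ ∂_λ g_{μν} + g_{μλ} ∂_ν ξ^λ + g_{λν} ∂_μ ξ^λ = 0; (ii) ξ^λ ∂_λ h^{μν} − h^{μλ} ∂_λ ξ^ν − h^{λν} ∂_λ ξ^μ = 0; (iii) ξ^λ ∂_λ Γ^μ_{νρ} − Γ^λ_{νρ} ∂_λ ξ^μ + Γ^μ_{λρ} ∂_ν ξ^λ +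 Γ^μ_{νλ} ∂_ρ ξ^λ + ∂_ν ∂_ρ ξ^μ = 0; then there exist a real 4×4 matrix A with Aᵀη + ηA = 0 and b ∈ ℝ⁴ such that ξ(x) = A x + (b·x) x for all x ∈ U. In other words, every simultaneous symmetry of (g, h, Γ) is a 𝔭₂ vector field. -/
noncomputable section

open scoped BigOperators

set_option linter.unusedSimpArgs false

def eps (μ : Fin 4) : ℝ := if μ = 0 then 1 else -1

lemma etaF_eq (μ ν : Fin 4) : etaF μ ν = if μ = ν then eps μ else 0 := by
  simp [etaF, eps]

lemma eps_ne (μ : Fin 4) : eps μ ≠ 0 := by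
  unfold eps; split_ifs <;> norm_num

lemma eps_sq (μ : Fin 4) : eps μ * eps μ = 1 := by
  unfold eps; split_ifs <;> norm_num

lemma lowr_eq (x : Fin 4 → ℝ) (μ : Fin 4) : lowr x μ = eps μ * x μ := by
  simp [lowr, etaF_eq]

lemma mdot_eq (x y : Fin 4 → ℝ) : mdot x y = ∑ μ, eps μ * x μ * y μ := by
  simp [mdot, etaF_eq]

lemma mdot_eq' (x y : Fin 4 → ℝ) : mdot x y = ∑ μ, lowr x μ * y μ := by
  simp [mdot_eq, lowr_eq]

lemma mdot_comm (x y : Fin 4 → ℝ) : mdot x y = mdot y x := by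
  rw [mdot_eq, mdot_eq]; exact Finset.sum_congr rfl fun i _ => by ring

lemma fderiv_sum_pdv (f : (Fin 4 → ℝ) → ℝ) (x v : Fin 4 → ℝ) :
    fderiv ℝ f x v = ∑ lam, v lam * pdv f lam x := by
  conv_lhs => rw [show v = ∑ i, v i • (Pi.single i 1 : Fin 4 → ℝ) by
    ext j; simp [Finset.sum_apply, Pi.single_apply]]
  simp only [map_sum, map_smul, smul_eq_mul, pdv]

/-- the linear functional `v ↦ v_μ` -/
def lowL (μ : Fin 4) : (Fin 4 → ℝ) →L[ℝ] ℝ := eps μ • ContinuousLinearMap.proj (R := ℝ) μ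

lemma lowL_apply (μ : Fin 4) (v : Fin 4 → ℝ) : lowL μ v = lowr v μ := by
  simp [lowL, lowr_eq]

lemma hasFDerivAt_lowr (μ : Fin 4) (x : Fin 4 → ℝ) :
    HasFDerivAt (fun y => lowr y μ) (lowL μ) x := by
  have : (fun y => lowr y μ) = lowL μ := by ext y; rw [lowL_apply]
  rw [this]; exact (lowL μ).hasFDerivAt

lemma hasFDerivAt_coord (μ : Fin 4) (x : Fin 4 → ℝ) :
    HasFDerivAt (fun y : Fin 4 → ℝ => y μ) (ContinuousLinearMap.proj (R := ℝ) μ) x :=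
  (ContinuousLinearMap.proj (R := ℝ) (φ := fun _ : Fin 4 => ℝ) μ).hasFDerivAt

/-- the linear functional `v ↦ x·v` -/
def dotL (x : Fin 4 → ℝ) : (Fin 4 → ℝ) →L[ℝ] ℝ :=
  ∑ μ, lowr x μ • ContinuousLinearMap.proj (R := ℝ) μ

lemma dotL_apply (x v : Fin 4 → ℝ) : dotL x v = mdot x v := by
  simp [dotL, mdot_eq']

lemma hasFDerivAt_s (x : Fin 4 → ℝ) :
    HasFDerivAt (fun y => mdot y y) ((2 : ℝ) • dotL x) x := by
  have h : HasFDerivAt (fun y : Fin 4 → ℝ => ∑ μ, lowr y μ * y μ)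
      (∑ μ, (lowr x μ • ContinuousLinearMap.proj (R := ℝ) μ + x μ • lowL μ)) x :=
    HasFDerivAt.fun_sum fun μ _ => (hasFDerivAt_lowr μ x).mul (hasFDerivAt_coord μ x)
  simp only [mdot_eq']
  convert h using 1
  ext v
  simp only [_root_.smul_apply, dotL_apply, _root_.sum_apply,
    _root_.add_apply, lowL_apply, ContinuousLinearMap.proj_apply, smul_eq_mul,
    mdot_eq', Finset.mul_sum, lowr_eq]
  exact Finset.sum_congr rfl fun i _ => by ring

lemma hasFDerivAt_quot {f g : (Fin 4 → ℝ) → ℝ} {f' g' : (Fin 4 → ℝ) →L[ℝ] ℝ} {x : Fin 4 → ℝ}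
    (hf : HasFDerivAt f f' x) (hg : HasFDerivAt g g' x) (h0 : g x ≠ 0) :
    HasFDerivAt (fun y => f y / g y) ((1 / g x) • f' - (f x / g x ^ 2) • g') x := by
  have h1 := hf.mul ((hasDerivAt_inv h0).comp_hasFDerivAt x hg)
  simp only [div_eq_mul_inv]
  refine h1.congr_fderiv ?_
  ext v
  simp only [_root_.add_apply, _root_.smul_apply, _root_.sub_apply, smul_eq_mul, Function.comp_apply]
  ring

lemma sym_zero (x F : Fin 4 → ℝ) (hx : mdot x x ≠ 0)
    (h : ∀ μ ν, x μ * F ν + x ν * F μ = 0) : ∀ ν, F ν = 0 := by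
  obtain ⟨κ, hκ⟩ : ∃ κ, x κ ≠ 0 := by
    by_contra hc
    push Not at hc
    exact hx (by simp [mdot_eq, hc])
  have h0 : F κ = 0 := by
    have := h κ κ
    have : x κ * F κ = 0 := by linarith
    exact (mul_eq_zero.1 this).resolve_left hκ
  intro ν
  have := h κ ν
  rw [h0, mul_zero, add_zero] at this
  exact (mul_eq_zero.1 this).resolve_left hκ

section fields
variable (ξf : (Fin 4 → ℝ) → Fin 4 → ℝ)

def Kf (μ ν : Fin 4) (x : Fin 4 → ℝ) : ℝ := pdv (fun y => ξf y μ) ν x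
def bet (x : Fin 4 → ℝ) : ℝ := mdot x (ξf x) / mdot x x
def Df (ν : Fin 4) (x : Fin 4 → ℝ) : ℝ := ∑ lam, lowr x lam * Kf ξf lam ν x
def Bf (ν : Fin 4) (x : Fin 4 → ℝ) : ℝ :=
  (Df ξf ν x + lowr (ξf x) ν) / mdot x x - 2 * lowr x ν * bet ξf x / mdot x x
def Af (μ ν : Fin 4) (x : Fin 4 → ℝ) : ℝ :=
  Kf ξf μ ν x - Bf ξf ν x * x μ - bet ξf x * (if μ = ν then 1 else 0)

/-- consequence of the invariance of `Γ` -/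
lemma conn_eq (x : Fin 4 → ℝ) (hs : mdot x x ≠ 0) (μ ν ρ : Fin 4)
    (h : lieConn ξf GammaC x μ ν ρ = 0) :
    pdv (Kf ξf μ ρ) ν x = (if μ = ρ then 1 else 0) * Bf ξf ν x
      + (if μ = ν then 1 else 0) * Bf ξf ρ x := by
  have hd : HasFDerivAt (fun y => GammaC y μ ν ρ) _ x :=
    hasFDerivAt_quot ((((hasFDerivAt_lowr ν x).mul_const (if μ = ρ then (1:ℝ) else 0)).add
      ((hasFDerivAt_lowr ρ x).const_mul (if μ = ν then (1:ℝ) else 0))).neg)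
      (hasFDerivAt_s x) hs
  unfold lieConn at h
  rw [← fderiv_sum_pdv, hd.fderiv] at h
  have e1 : ∑ lam, GammaC x lam ν ρ * pdv (fun y => ξf y μ) lam x
      = -(lowr x ν * Kf ξf μ ρ x + lowr x ρ * Kf ξf μ ν x) / mdot x x := by
    have : ∀ lam, GammaC x lam ν ρ * pdv (fun y => ξf y μ) lam x
      = (if lam = ρ then -(lowr x ν * Kf ξf μ lam x) / mdot x x else 0)
        + (if lam = ν then -(lowr x ρ * Kf ξf μ lam x) / mdot x x else 0) := by
      intro lam
      unfold GammaC Kf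
      split_ifs <;> ring
    simp only [this, Finset.sum_add_distrib, Finset.sum_ite_eq', Finset.mem_univ, if_true]
    ring
  have e2 : ∑ lam, GammaC x μ lam ρ * pdv (fun y => ξf y lam) ν x
      = -((if μ = ρ then 1 else 0) * Df ξf ν x + lowr x ρ * Kf ξf μ ν x) / mdot x x := by
    have : ∀ lam, GammaC x μ lam ρ * pdv (fun y => ξf y lam) ν x
      = -((if μ = ρ then 1 else 0) / mdot x x) * (lowr x lam * Kf ξf lam ν x)
        + (if μ = lam then -(lowr x ρ * Kf ξf lam ν x) / mdot x x else 0) := by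
      intro lam
      unfold GammaC Kf
      split_ifs <;> ring
    simp only [this, Finset.sum_add_distrib, Finset.sum_ite_eq, Finset.mem_univ, if_true,
      ← Finset.mul_sum, Df]
    ring
  have e3 : ∑ lam, GammaC x μ ν lam * pdv (fun y => ξf y lam) ρ x
      = -((if μ = ν then 1 else 0) * Df ξf ρ x + lowr x ν * Kf ξf μ ρ x) / mdot x x := by
    have : ∀ lam, GammaC x μ ν lam * pdv (fun y => ξf y lam) ρ x
      = -((if μ = ν then 1 else 0) / mdot x x) * (lowr x lam * Kf ξf lam ρ x)
        + (if μ = lam then -(lowr x ν * Kf ξf lam ρ x) / mdot x x else 0) := by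
      intro lam
      unfold GammaC Kf
      split_ifs <;> ring
    simp only [this, Finset.sum_add_distrib, Finset.sum_ite_eq, Finset.mem_univ, if_true,
      ← Finset.mul_sum, Df]
    ring
  rw [e1, e2, e3] at h
  have e4 : pdv (fun y => pdv (fun z => ξf z μ) ρ y) ν x = pdv (Kf ξf μ ρ) ν x := rfl
  rw [e4] at h
  rw [← sub_eq_zero]
  refine Eq.trans ?_ h
  simp only [_root_.smul_apply, _root_.sub_apply,
    _root_.add_apply, _root_.neg_apply, dotL_apply, lowL_apply,
    smul_eq_mul, Bf, bet, Pi.add_apply, Pi.neg_apply]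
  field_simp
  ring

lemma g_eq (x : Fin 4 → ℝ) (hs : mdot x x ≠ 0) (μ ν : Fin 4)
    (h : lieG ξf gC x μ ν = 0) :
    eps μ * Af ξf μ ν x + eps ν * Af ξf ν μ x = 0 := by
  have hd : HasFDerivAt (fun y => gC y μ ν) _ x :=
    hasFDerivAt_quot (((hasFDerivAt_lowr μ x).mul (hasFDerivAt_lowr ν x)).sub
      ((hasFDerivAt_s x).mul_const (etaF μ ν)))
      ((hasFDerivAt_s x).pow 2) (pow_ne_zero 2 hs)
  unfold lieG at h
  rw [← fderiv_sum_pdv, hd.fderiv] at h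
  have e1 : ∑ lam, gC x μ lam * pdv (fun y => ξf y lam) ν x
      = (lowr x μ * Df ξf ν x - mdot x x * (eps μ * Kf ξf μ ν x)) / mdot x x ^ 2 := by
    have : ∀ lam, gC x μ lam * pdv (fun y => ξf y lam) ν x
      = lowr x μ / mdot x x ^ 2 * (lowr x lam * Kf ξf lam ν x)
        + (if μ = lam then - mdot x x * (eps μ * Kf ξf lam ν x) / mdot x x ^ 2 else 0) := by
      intro lam
      unfold gC Kf
      rw [etaF_eq]
      split_ifs <;> ring
    simp only [this, Finset.sum_add_distrib, Finset.sum_ite_eq, Finset.mem_univ, if_true,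
      ← Finset.mul_sum, Df]
    ring
  have e2 : ∑ lam, gC x lam ν * pdv (fun y => ξf y lam) μ x
      = (lowr x ν * Df ξf μ x - mdot x x * (eps ν * Kf ξf ν μ x)) / mdot x x ^ 2 := by
    have : ∀ lam, gC x lam ν * pdv (fun y => ξf y lam) μ x
      = lowr x ν / mdot x x ^ 2 * (lowr x lam * Kf ξf lam μ x)
        + (if lam = ν then - mdot x x * (eps lam * Kf ξf lam μ x) / mdot x x ^ 2 else 0) := by
      intro lam
      unfold gC Kf
      rw [etaF_eq]
      split_ifs <;> ring
    simp only [this, Finset.sum_add_distrib, Finset.sum_ite_eq', Finset.mem_univ, if_true,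
      ← Finset.mul_sum, Df]
    ring
  rw [e1, e2] at h
  have e3 : eps μ * (if μ = ν then (1:ℝ) else 0) = etaF μ ν := by rw [etaF_eq]; simp
  have e4 : eps ν * (if ν = μ then (1:ℝ) else 0) = etaF μ ν := by
    rw [etaF_eq]; simp only [eq_comm (a := ν)]; split_ifs with h
    · rw [h]; ring
    · ring
  have e5 : eps μ * Af ξf μ ν x + eps ν * Af ξf ν μ x = eps μ * Kf ξf μ ν x + eps ν * Kf ξf ν μ x
      - Bf ξf ν x * lowr x μ - Bf ξf μ x * lowr x ν - 2 * bet ξf x * etaF μ ν := by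
    unfold Af
    rw [lowr_eq, lowr_eq]
    linear_combination (-bet ξf x) * e3 + (-bet ξf x) * e4
  rw [e5]
  simp only [_root_.smul_apply, _root_.sub_apply,
    _root_.add_apply, _root_.neg_apply, dotL_apply, lowL_apply,
    smul_eq_mul, Pi.sub_apply, Pi.mul_apply] at h
  have h' : (-mdot x x) * (0:ℝ) = 0 := by simp
  rw [← h', ← h]
  unfold Bf bet
  field_simp
  ring

lemma h_eq (x : Fin 4 → ℝ) (hs : mdot x x ≠ 0)
    (h : ∀ μ ν, lieH ξf hC x μ ν = 0) (ν : Fin 4) :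
    ξf x ν + bet ξf x * x ν - ∑ lam, x lam * Kf ξf ν lam x = 0 := by
  refine sym_zero x (fun ν => ξf x ν + bet ξf x * x ν - ∑ lam, x lam * Kf ξf ν lam x) hs ?_ ν
  intro μ ν
  have h := h μ ν
  have hd : HasFDerivAt (fun y => hC y μ ν) _ x :=
    ((hasFDerivAt_s x).mul (hasFDerivAt_coord μ x)).mul (hasFDerivAt_coord ν x)
  unfold lieH at h
  rw [← fderiv_sum_pdv, hd.fderiv] at h
  have e1 : ∑ lam, hC x μ lam * pdv (fun y => ξf y ν) lam x
      = mdot x x * x μ * ∑ lam, x lam * Kf ξf ν lam x := by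
    rw [Finset.mul_sum]
    exact Finset.sum_congr rfl fun i _ => by unfold hC Kf; ring
  have e2 : ∑ lam, hC x lam ν * pdv (fun y => ξf y μ) lam x
      = mdot x x * x ν * ∑ lam, x lam * Kf ξf μ lam x := by
    rw [Finset.mul_sum]
    exact Finset.sum_congr rfl fun i _ => by unfold hC Kf; ring
  rw [e1, e2] at h
  simp only [_root_.smul_apply, ContinuousLinearMap.proj_apply,
    _root_.add_apply, dotL_apply, smul_eq_mul, Pi.mul_apply] at h
  apply mul_left_cancel₀ hs
  rw [mul_zero, ← h]
  unfold bet
  field_simp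
  ring

lemma xi_eq (x : Fin 4 → ℝ) (hs : mdot x x ≠ 0)
    (h : ∀ μ ν, lieH ξf hC x μ ν = 0) (μ : Fin 4) :
    ξf x μ = ∑ ν, Af ξf μ ν x * x ν + (∑ ν, Bf ξf ν x * x ν) * x μ := by
  have hE := h_eq ξf x hs h
  have e1 : ∑ ν, Af ξf μ ν x * x ν = ∑ lam, x lam * Kf ξf μ lam x
      - (∑ ν, Bf ξf ν x * x ν) * x μ - bet ξf x * x μ := by
    have : ∀ ν, Af ξf μ ν x * x ν = x ν * Kf ξf μ ν x - Bf ξf ν x * x ν * x μ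
        - (if μ = ν then bet ξf x * x ν else 0) := by
      intro ν; unfold Af; split_ifs <;> ring
    simp only [this, Finset.sum_sub_distrib, Finset.sum_ite_eq, Finset.mem_univ, if_true,
      Finset.sum_mul]
  rw [e1]
  linarith [hE μ]

end fields

section fields2
variable (ξf : (Fin 4 → ℝ) → Fin 4 → ℝ)

lemma K_diff {x : Fin 4 → ℝ} (hc : ∀ μ, ContDiffAt ℝ (⊤ : ℕ∞) (fun x => ξf x μ) x) (μ ν : Fin 4) :
    DifferentiableAt ℝ (Kf ξf μ ν) x := by
  have h1 : ContDiffAt ℝ 1 (fderiv ℝ (fun x => ξf x μ)) x :=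
    (hc μ).fderiv_right (m := 1) (by
      have h : ((2 : ℕ∞) : WithTop ℕ∞) ≤ ((⊤ : ℕ∞) : WithTop ℕ∞) := WithTop.coe_le_coe.2 le_top
      have h2 : (1 : WithTop ℕ∞) + 1 = ((2 : ℕ∞) : WithTop ℕ∞) := by norm_num
      rw [h2]; exact h)
  exact (h1.differentiableAt one_ne_zero).clm_apply (differentiableAt_const _)

lemma xi_diff {x : Fin 4 → ℝ} (hc : ∀ μ, ContDiffAt ℝ (⊤ : ℕ∞) (fun x => ξf x μ) x) (μ : Fin 4) :
    DifferentiableAt ℝ (fun y => ξf y μ) x :=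
  (hc μ).differentiableAt (by simp)

lemma bet_diff {x : Fin 4 → ℝ} (hs : mdot x x ≠ 0)
    (hc : ∀ μ, ContDiffAt ℝ (⊤ : ℕ∞) (fun x => ξf x μ) x) :
    DifferentiableAt ℝ (bet ξf) x ∧ ∀ ρ, pdv (bet ξf) ρ x = Bf ξf ρ x := by
  have h1 : HasFDerivAt (fun y => ∑ μ, lowr y μ * ξf y μ) _ x :=
    HasFDerivAt.fun_sum fun μ _ => (hasFDerivAt_lowr μ x).mul (xi_diff ξf hc μ).hasFDerivAt
  have h2 := hasFDerivAt_quot h1 (hasFDerivAt_s x) hs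
  have e : bet ξf = fun y => (∑ μ, lowr y μ * ξf y μ) / mdot y y := by
    ext y; rw [bet, mdot_eq']
  rw [← e] at h2
  refine ⟨h2.differentiableAt, fun ρ => ?_⟩
  have e1 : ∑ μ, ξf x μ * lowr (Pi.single ρ 1 : Fin 4 → ℝ) μ = lowr (ξf x) ρ := by
    simp [lowr_eq, Pi.single_apply, mul_comm]
  have e2 : mdot x (Pi.single ρ 1 : Fin 4 → ℝ) = lowr x ρ := by
    simp [mdot_eq', Pi.single_apply]
  have e3 : ∑ μ, lowr x μ * (fderiv ℝ (fun y => ξf y μ) x) (Pi.single ρ 1) = Df ξf ρ x := rfl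
  rw [pdv, h2.fderiv]
  simp only [_root_.sub_apply, _root_.smul_apply, _root_.sum_apply, _root_.add_apply, lowL_apply,
    dotL_apply, smul_eq_mul, Finset.sum_add_distrib, e1, e2, e3]
  rw [Bf, bet, mdot_eq' x (ξf x)]
  field_simp

lemma B_diff {x : Fin 4 → ℝ} (hs : mdot x x ≠ 0)
    (hc : ∀ μ, ContDiffAt ℝ (⊤ : ℕ∞) (fun x => ξf x μ) x) (ν : Fin 4) :
    DifferentiableAt ℝ (Bf ξf ν) x := by
  have hl : ∀ μ, DifferentiableAt ℝ (fun y => lowr y μ) x :=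
    fun μ => (hasFDerivAt_lowr μ x).differentiableAt
  have hS : DifferentiableAt ℝ (fun y => mdot y y) x := (hasFDerivAt_s x).differentiableAt
  have hD : DifferentiableAt ℝ (Df ξf ν) x :=
    DifferentiableAt.fun_sum fun μ _ => (hl μ).mul (K_diff ξf hc μ ν)
  have hx : DifferentiableAt ℝ (fun y => lowr (ξf y) ν) x := by
    simp only [lowr_eq]
    exact (xi_diff ξf hc ν).const_mul _
  have hb := (bet_diff ξf hs hc).1
  exact (hasFDerivAt_quot (hD.add hx).hasFDerivAt hS.hasFDerivAt hs).differentiableAt.sub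
    (hasFDerivAt_quot (((hl ν).const_mul 2).mul hb).hasFDerivAt hS.hasFDerivAt hs).differentiableAt

lemma A_diff {x : Fin 4 → ℝ} (hs : mdot x x ≠ 0)
    (hc : ∀ μ, ContDiffAt ℝ (⊤ : ℕ∞) (fun x => ξf x μ) x)
    (hG : ∀ μ ν ρ, lieConn ξf GammaC x μ ν ρ = 0) (μ ν : Fin 4) :
    DifferentiableAt ℝ (Af ξf μ ν) x ∧
      ∀ ρ, pdv (Af ξf μ ν) ρ x = - pdv (Bf ξf ν) ρ x * x μ := by
  have h : HasFDerivAt (Af ξf μ ν) _ x :=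
    ((K_diff ξf hc μ ν).hasFDerivAt.sub
      ((B_diff ξf hs hc ν).hasFDerivAt.mul (hasFDerivAt_coord μ x))).sub
      ((bet_diff ξf hs hc).1.hasFDerivAt.mul_const (if μ = ν then (1:ℝ) else 0))
  refine ⟨h.differentiableAt, fun ρ => ?_⟩
  have e1 := conn_eq ξf x hs μ ρ ν (hG μ ρ ν)
  have e2 := (bet_diff ξf hs hc).2 ρ
  rw [pdv, h.fderiv]
  unfold pdv at e1 e2 ⊢
  simp only [_root_.sub_apply, _root_.smul_apply, _root_.add_apply, smul_eq_mul, e1, e2,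
    ContinuousLinearMap.proj_apply, Pi.single_apply]
  ring

end fields2

lemma mdot_expand (x : Fin 4 → ℝ) :
    mdot x x = x 0 ^ 2 - (x 1 ^ 2 + x 2 ^ 2 + x 3 ^ 2) := by
  rw [mdot_eq]; simp [Fin.sum_univ_four, eps]; ring

lemma s_cont : Continuous fun y : Fin 4 → ℝ => mdot y y := by
  simp only [mdot_expand]; fun_prop

/-- spatial norm -/
def nrm (v : Fin 3 → ℝ) : ℝ := Real.sqrt (v 0 ^ 2 + v 1 ^ 2 + v 2 ^ 2)

lemma nrm_sq (v : Fin 3 → ℝ) : nrm v ^ 2 = v 0 ^ 2 + v 1 ^ 2 + v 2 ^ 2 :=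
  Real.sq_sqrt (by positivity)

lemma nrm_nonneg (v : Fin 3 → ℝ) : 0 ≤ nrm v := Real.sqrt_nonneg _

lemma nrm_cont : Continuous nrm := by unfold nrm; fun_prop

lemma nrm_pos {v : Fin 3 → ℝ} (hv : v ≠ 0) : 0 < nrm v := by
  rcases (nrm_nonneg v).lt_or_eq with h | h
  · exact h
  · exfalso
    have h2 := nrm_sq v
    rw [← h] at h2
    apply hv
    have a0 : v 0 = 0 := by nlinarith [sq_nonneg (v 0), sq_nonneg (v 1), sq_nonneg (v 2)]
    have a1 : v 1 = 0 := by nlinarith [sq_nonneg (v 0), sq_nonneg (v 1), sq_nonneg (v 2)]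
    have a2 : v 2 = 0 := by nlinarith [sq_nonneg (v 0), sq_nonneg (v 1), sq_nonneg (v 2)]
    ext i; fin_cases i <;> simp [a0, a1, a2]

lemma conn_space : IsPreconnected {x : Fin 4 → ℝ | mdot x x < 0} := by
  have h1 : IsPreconnected (Set.Ioo (-1:ℝ) 1 ×ˢ ({0}ᶜ : Set (Fin 3 → ℝ))) :=
    isPreconnected_Ioo.prod
      (isConnected_compl_singleton_of_one_lt_rank (by simp) 0).isPreconnected
  have h2 := h1.image (fun p : ℝ × (Fin 3 → ℝ) => (Fin.cons (p.1 * nrm p.2) p.2 : Fin 4 → ℝ)) (by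
    apply Continuous.continuousOn
    have := nrm_cont
    refine continuous_pi fun i => ?_
    refine Fin.cases ?_ (fun j => ?_) i
    · simp only [Fin.cons_zero]; fun_prop
    · simp only [Fin.cons_succ]; fun_prop)
  convert h2 using 1
  ext x
  simp only [Set.mem_ofPred_eq, Set.mem_image, Set.mem_prod, Set.mem_Ioo, Set.mem_compl_iff,
    Set.mem_singleton_iff, Prod.exists]
  have hn := nrm_sq (Fin.tail x)
  simp only [Fin.tail] at hn
  change nrm (Fin.tail x) ^ 2 = x 1 ^ 2 + x 2 ^ 2 + x 3 ^ 2 at hn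
  constructor
  · intro hx
    rw [mdot_expand, ← hn] at hx
    have hp : 0 < nrm (Fin.tail x) := by
      rcases (nrm_nonneg (Fin.tail x)).lt_or_eq with h | h
      · exact h
      · rw [← h] at hx; nlinarith [sq_nonneg (x 0)]
    have := abs_lt.1 (abs_lt_of_sq_lt_sq (by linarith : x 0 ^ 2 < nrm (Fin.tail x) ^ 2) hp.le)
    refine ⟨x 0 / nrm (Fin.tail x), Fin.tail x, ⟨⟨?_, ?_⟩, ?_⟩, ?_⟩
    · rw [lt_div_iff₀ hp]; linarith
    · rw [div_lt_iff₀ hp]; linarith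
    · intro h0; rw [h0] at hp; simp [nrm] at hp
    · rw [div_mul_cancel₀ _ hp.ne']; exact Fin.cons_self_tail x
  · rintro ⟨t, v, ⟨⟨ha, hb⟩, hv⟩, rfl⟩
    have hp := nrm_pos hv
    have hn := nrm_sq v
    rw [mdot_expand]
    change (t * nrm v) ^ 2 - (v 0 ^ 2 + v 1 ^ 2 + v 2 ^ 2) < 0
    rw [← hn]
    have h1 : t ^ 2 < 1 := by nlinarith
    nlinarith [pow_pos hp 2]

lemma conn_time : IsPreconnected {x : Fin 4 → ℝ | 0 < mdot x x ∧ 0 < x 0} := by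
  have h1 : IsPreconnected (Set.Ioi (0:ℝ) ×ˢ (Set.univ : Set (Fin 3 → ℝ))) :=
    isPreconnected_Ioi.prod isPreconnected_univ
  have h2 := h1.image (fun p : ℝ × (Fin 3 → ℝ) => (Fin.cons (p.1 + nrm p.2) p.2 : Fin 4 → ℝ)) (by
    apply Continuous.continuousOn
    have := nrm_cont
    refine continuous_pi fun i => ?_
    refine Fin.cases ?_ (fun j => ?_) i
    · simp only [Fin.cons_zero]; fun_prop
    · simp only [Fin.cons_succ]; fun_prop)
  convert h2 using 1
  ext x
  simp only [Set.mem_ofPred_eq, Set.mem_image, Set.mem_prod, Set.mem_Ioi, Set.mem_univ, and_true,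
    Prod.exists]
  have hn := nrm_sq (Fin.tail x)
  simp only [Fin.tail] at hn
  change nrm (Fin.tail x) ^ 2 = x 1 ^ 2 + x 2 ^ 2 + x 3 ^ 2 at hn
  constructor
  · rintro ⟨hx, h0⟩
    rw [mdot_expand, ← hn] at hx
    refine ⟨x 0 - nrm (Fin.tail x), Fin.tail x, ?_, ?_⟩
    · nlinarith [nrm_nonneg (Fin.tail x)]
    · rw [sub_add_cancel]; exact Fin.cons_self_tail x
  · rintro ⟨t, v, ht, rfl⟩
    have hn := nrm_sq v
    have hp := nrm_nonneg v
    rw [mdot_expand]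
    change 0 < (t + nrm v) ^ 2 - (v 0 ^ 2 + v 1 ^ 2 + v 2 ^ 2) ∧ 0 < t + nrm v
    rw [← hn]
    constructor
    · nlinarith [mul_nonneg ht.le hp, pow_pos ht 2]
    · linarith

lemma fderiv_zero_of_pdv {f : (Fin 4 → ℝ) → ℝ} {x : Fin 4 → ℝ} (h : ∀ ρ, pdv f ρ x = 0) :
    fderiv ℝ f x = 0 := by
  ext v
  rw [fderiv_sum_pdv]; simp [h]

/-- Maximum symmetry theorem: on either region, each smooth vector field preserving the
degenerate metrics g, h and the canonical connection Γ is a 𝔭₂ vector field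
ξ(x) = A x + (b·x) x with A ∈ 𝔰𝔬(1,3) and b ∈ ℝ⁴. -/
theorem stmt_6 (U : Set (Fin 4 → ℝ))
    (hUcase : U = {x : Fin 4 → ℝ | mdot x x < 0} ∨
      U = {x : Fin 4 → ℝ | 0 < mdot x x ∧ 0 < x 0})
    (ξf : (Fin 4 → ℝ) → Fin 4 → ℝ)
    (hsmooth : ∀ μ, ContDiffOn ℝ (⊤ : ℕ∞) (fun x => ξf x μ) U)
    (hg : ∀ x ∈ U, ∀ μ ν, lieG ξf gC x μ ν = 0)
    (hh : ∀ x ∈ U, ∀ μ ν, lieH ξf hC x μ ν = 0)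
    (hGamma : ∀ x ∈ U, ∀ μ ν ρ, lieConn ξf GammaC x μ ν ρ = 0) :
    ∃ A : Fin 4 → Fin 4 → ℝ, ∃ b : Fin 4 → ℝ, so13 A ∧
      ∀ x ∈ U, ξf x = xiP2 A b x := by
  have hopen : IsOpen U := by
    rcases hUcase with rfl | rfl
    · exact isOpen_lt s_cont continuous_const
    · exact (isOpen_lt continuous_const s_cont).inter
        (isOpen_lt continuous_const (continuous_apply 0))
  have hconn : IsPreconnected U := by
    rcases hUcase with rfl | rfl
    · exact conn_space
    · exact conn_time
  have hs : ∀ x ∈ U, mdot x x ≠ 0 := by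
    rcases hUcase with rfl | rfl
    · exact fun x hx => ne_of_lt hx
    · exact fun x hx => ne_of_gt hx.1
  have hc : ∀ x ∈ U, ∀ μ, ContDiffAt ℝ (⊤ : ℕ∞) (fun x => ξf x μ) x :=
    fun x hx μ => (hsmooth μ).contDiffAt (hopen.mem_nhds hx)
  have hanti : ∀ x ∈ U, ∀ μ ν, eps μ * Af ξf μ ν x + eps ν * Af ξf ν μ x = 0 :=
    fun x hx μ ν => g_eq ξf x (hs x hx) μ ν (hg x hx μ ν)
  have hA : ∀ x ∈ U, ∀ μ ν, DifferentiableAt ℝ (Af ξf μ ν) x :=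
    fun x hx μ ν => (A_diff ξf (hs x hx) (hc x hx) (hGamma x hx) μ ν).1
  have hA' : ∀ x ∈ U, ∀ μ ν ρ, pdv (Af ξf μ ν) ρ x = - pdv (Bf ξf ν) ρ x * x μ :=
    fun x hx μ ν => (A_diff ξf (hs x hx) (hc x hx) (hGamma x hx) μ ν).2
  have hanti' : ∀ x ∈ U, ∀ μ ν ρ,
      eps μ * pdv (Af ξf μ ν) ρ x + eps ν * pdv (Af ξf ν μ) ρ x = 0 := by
    intro x hx μ ν ρ
    have h1 := ((hA x hx μ ν).hasFDerivAt.const_mul (eps μ)).add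
      ((hA x hx ν μ).hasFDerivAt.const_mul (eps ν))
    have h2 : HasFDerivAt (fun y => eps μ * Af ξf μ ν y + eps ν * Af ξf ν μ y)
        (0 : (Fin 4 → ℝ) →L[ℝ] ℝ) x := by
      refine (hasFDerivAt_const (0:ℝ) x).congr_of_eventuallyEq ?_
      filter_upwards [hopen.mem_nhds hx] with y hy using hanti y hy μ ν
    have h3 := h1.unique h2
    have h4 := congrArg (fun L : (Fin 4 → ℝ) →L[ℝ] ℝ => L (Pi.single ρ 1)) h3
    simpa [pdv] using h4
  have hB' : ∀ x ∈ U, ∀ ν ρ, pdv (Bf ξf ν) ρ x = 0 := by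
    intro x hx ν ρ
    have h := sym_zero x (fun ν => eps ν * pdv (Bf ξf ν) ρ x) (hs x hx) (by
      intro μ ν
      have h1 := hanti' x hx μ ν ρ
      rw [hA' x hx, hA' x hx] at h1
      linear_combination (-(eps μ * eps ν)) * h1 - x μ * eps ν * pdv (Bf ξf ν) ρ x * eps_sq μ
        - x ν * eps μ * pdv (Bf ξf μ) ρ x * eps_sq ν) ν
    exact (mul_eq_zero.1 h).resolve_left (eps_ne ν)
  have cB : ∀ ν, ∃ a, ∀ x ∈ U, Bf ξf ν x = a := fun ν =>
    hopen.exists_is_const_of_fderiv_eq_zero (𝕜 := ℝ) hconn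
      (fun x hx => (B_diff ξf (hs x hx) (hc x hx) ν).differentiableWithinAt)
      (fun x hx => fderiv_zero_of_pdv (hB' x hx ν))
  have cA : ∀ μ ν, ∃ a, ∀ x ∈ U, Af ξf μ ν x = a := fun μ ν =>
    hopen.exists_is_const_of_fderiv_eq_zero (𝕜 := ℝ) hconn
      (fun x hx => (hA x hx μ ν).differentiableWithinAt)
      (fun x hx => fderiv_zero_of_pdv (fun ρ => by rw [hA' x hx, hB' x hx]; simp))
  choose B hB using cB
  choose A hAc using cA
  have hne : ∃ x, x ∈ U := by
    rcases hUcase with rfl | rfl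
    · refine ⟨fun i => if i = 1 then 1 else 0, ?_⟩
      simp [mdot_expand]
    · refine ⟨fun i => if i = 0 then 1 else 0, ?_⟩
      simp [mdot_expand]
  obtain ⟨x₀, hx₀⟩ := hne
  refine ⟨A, fun ν => eps ν * B ν, ?_, ?_⟩
  · intro μ ν
    have h := hanti x₀ hx₀ μ ν
    rw [hAc μ ν x₀ hx₀, hAc ν μ x₀ hx₀] at h
    have e1 : ∑ κ, A κ μ * etaF κ ν = A ν μ * eps ν := by simp [etaF_eq]
    have e2 : ∑ κ, etaF μ κ * A κ ν = eps μ * A μ ν := by simp [etaF_eq]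
    rw [e1, e2]; linarith
  · intro x hx
    ext μ
    rw [xi_eq ξf x (hs x hx) (hh x hx) μ]
    have e1 : mdot (fun ν => eps ν * B ν) x = ∑ ν, Bf ξf ν x * x ν := by
      rw [mdot_eq]
      refine Finset.sum_congr rfl fun ν _ => ?_
      rw [hB ν x hx, ← mul_assoc, eps_sq, one_mul]
    have e2 : ∑ ν, Af ξf μ ν x * x ν = ∑ ν, A μ ν * x ν :=
      Finset.sum_congr rfl fun ν _ => by rw [hAc μ ν x hx]
    rw [xiP2, e1, e2]
end
end
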